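/- Let G be a group with center Z(G), let H be a group, and let σ : H × ℤ → G be a group homomorphism. Then σ is irreducible if and only if the centralizer in G of the image σ(H × {0}) of the first factor equals Z(G). Moreover, if σ is irreducible, then σ(1, n) lies in Z(G) for every n ∈ ℤ. -/

import Mathlib

/-- For a group homomorphism `σ : H × ℤ → G` (with `ℤ` written multiplicatively),
irreducibility of `σ` (i.e. the centralizer of its range is the center of `G`)
is equivalent to the centralizer of the image of the first factor being the
center of `G`; moreover if `σ` is irreducible then `σ (1, n)` is central for
every `n : ℤ`. -/
theorem stmt_0 {G H : Type*} [Group G] [Group H]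
    (σ : H × Multiplicative ℤ →* G) :
    (Subgroup.centralizer (Set.range σ) = Subgroup.center G ↔
      Subgroup.centralizer
        (Set.range fun h : H => σ (h, Multiplicative.ofAdd 0)) =
        Subgroup.center G) ∧
    (Subgroup.centralizer (Set.range σ) = Subgroup.center G →
      ∀ n : ℤ, σ (1, Multiplicative.ofAdd n) ∈ Subgroup.center G) := by
  have key : Subgroup.centralizer (Set.range σ) = Subgroup.center G →
      ∀ n : ℤ, σ (1, Multiplicative.ofAdd n) ∈ Subgroup.center G := by
    intro hσ n
    rw [← hσ, Subgroup.mem_centralizer_iff]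
    rintro _ ⟨⟨h, m⟩, rfl⟩
    rw [← map_mul, ← map_mul, Prod.mk_mul_mk, Prod.mk_mul_mk, mul_one, one_mul, mul_comm m]
  refine ⟨⟨fun hσ => ?_, fun hσ => ?_⟩, key⟩
  · refine le_antisymm ?_ (Subgroup.center_le_centralizer _)
    intro g hg
    rw [← hσ, Subgroup.mem_centralizer_iff]
    rintro _ ⟨⟨h, m⟩, rfl⟩
    have h1 : σ (h, Multiplicative.ofAdd 0) * g = g * σ (h, Multiplicative.ofAdd 0) :=
      Subgroup.mem_centralizer_iff.mp hg _ ⟨h, rfl⟩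
    have h2 : g * σ (1, m) = σ (1, m) * g :=
      Subgroup.mem_center_iff.mp (key hσ m.toAdd) g
    have h3 : σ (h, m) = σ (h, Multiplicative.ofAdd 0) * σ (1, m) := by
      rw [← map_mul, Prod.mk_mul_mk, mul_one, ofAdd_zero, one_mul]
    rw [h3, mul_assoc, ← h2, ← mul_assoc, h1, mul_assoc]
  · refine le_antisymm ?_ (Subgroup.center_le_centralizer _)
    rw [← hσ]
    apply Subgroup.centralizer_le
    rintro _ ⟨h, rfl⟩
    exact ⟨_, rfl⟩
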